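/- Rice formula for a stationary Gaussian process: let X be a centered stationary Gaussian process on ℝ with covariance r, r(0) = λ₀ > 0, spectral measure not purely discrete, and finite second spectral moment λ₂ = -r''(0) < ∞, with C¹ sample paths. Then for every level y ∈ ℝ and t > 0, E[N^X_{[0,t]}(y)] = (t/π) · √(λ₂/λ₀) · exp(-y²/(2λ₀)), where N^X_{[0,t]}(y) is the number of crossings of level y by X on [0,t]. -/

import Mathlib

open MeasureTheory ProbabilityTheory
open scoped NNReal ENNReal

open Filter Topology

lemma abs_gaussianPDFReal_sub_le {v : ℝ≥0} (hv : v ≠ 0) (x y : ℝ) :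
    |gaussianPDFReal 0 v x - gaussianPDFReal 0 v y|
      ≤ (√(2 * Real.pi * v))⁻¹ * ((1 / 2 + v) / v) * |x - y| := by
  have hv0 : (0 : ℝ) < v := by exact_mod_cast pos_iff_ne_zero.mpr hv
  have hder : ∀ x : ℝ, HasDerivAt (gaussianPDFReal 0 v)
      ((√(2 * Real.pi * v))⁻¹ * (Real.exp (-(x ^ 2) / (2 * v)) * (-x / v))) x := by
    intro x
    have h1 : HasDerivAt (fun x : ℝ => -(x ^ 2) / (2 * (v : ℝ))) (-x / v) x := by
      refine (((hasDerivAt_pow 2 x).neg).div_const (2 * (v : ℝ))).congr_deriv ?_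
      field_simp
      simp
    have h2 : gaussianPDFReal 0 v
        = fun x => (√(2 * Real.pi * v))⁻¹ * Real.exp (-(x ^ 2) / (2 * v)) := by
      ext z
      simp [gaussianPDFReal]
    rw [h2]
    exact (h1.exp).const_mul _
  have hbound : ∀ x ∈ Set.univ, ‖((√(2 * Real.pi * v))⁻¹ *
      (Real.exp (-(x ^ 2) / (2 * v)) * (-x / v)))‖
      ≤ (√(2 * Real.pi * v))⁻¹ * ((1 / 2 + v) / v) := by
    intro x _
    rw [norm_mul, norm_mul, Real.norm_of_nonneg (by positivity), Real.norm_of_nonneg (by positivity)]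
    gcongr
    rw [norm_div, norm_neg, Real.norm_of_nonneg hv0.le, Real.norm_eq_abs, ← mul_div_assoc]
    gcongr
    rw [neg_div, Real.exp_neg, inv_mul_le_iff₀ (Real.exp_pos _)]
    have h2 := Real.add_one_le_exp (x ^ 2 / (2 * v))
    have h3 : |x| ≤ (x ^ 2 / (2 * v) + 1) * (1 / 2 + v) := by
      have : x ^ 2 / (2 * v) * v = x ^ 2 / 2 := by field_simp
      have h4 : 0 ≤ x ^ 2 / (2 * v) := by positivity
      nlinarith [sq_nonneg (|x| - 1), sq_abs x]
    exact h3.trans (by gcongr)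
  have := convex_univ.norm_image_sub_le_of_norm_hasDerivWithin_le
    (fun x _ => (hder x).hasDerivWithinAt) hbound (Set.mem_univ y) (Set.mem_univ x)
  simpa [Real.norm_eq_abs] using this

lemma gaussianReal_real_Ioo_sub_le {v : ℝ≥0} (hv : v ≠ 0) (y : ℝ) {d : ℝ} (hd : 0 ≤ d) :
    |(gaussianReal 0 v).real (Set.Ioo (y - d) (y + d)) - 2 * d * gaussianPDFReal 0 v y|
      ≤ (√(2 * Real.pi * v))⁻¹ * ((1 / 2 + v) / v) * (2 * d ^ 2) := by
  have h1 : (gaussianReal 0 v).real (Set.Ioo (y - d) (y + d))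
      = ∫ x in Set.Ioo (y - d) (y + d), gaussianPDFReal 0 v x := by
    rw [measureReal_def, gaussianReal_apply_eq_integral _ hv, ENNReal.toReal_ofReal]
    exact integral_nonneg fun x => gaussianPDFReal_nonneg _ _ _
  have h2 : 2 * d * gaussianPDFReal 0 v y
      = ∫ x in Set.Ioo (y - d) (y + d), gaussianPDFReal 0 v y := by
    rw [setIntegral_const, measureReal_def, Real.volume_Ioo, ENNReal.toReal_ofReal (by linarith),
      smul_eq_mul]
    ring
  rw [h1, h2, ← integral_sub (integrable_gaussianPDFReal _ _).integrableOn (by simp)]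
  have := norm_setIntegral_le_of_norm_le_const (μ := volume) (s := Set.Ioo (y - d) (y + d))
    (f := fun x => gaussianPDFReal 0 v x - gaussianPDFReal 0 v y)
    (C := (√(2 * Real.pi * v))⁻¹ * ((1 / 2 + v) / v) * d) (by simp) (by
      intro x hx
      refine (abs_gaussianPDFReal_sub_le hv x y).trans ?_
      gcongr
      rw [abs_le]
      constructor <;> linarith [hx.1, hx.2])
  rw [Real.norm_eq_abs] at this
  refine this.trans (le_of_eq ?_)
  rw [measureReal_def, Real.volume_Ioo, ENNReal.toReal_ofReal (by linarith)]
  ring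

lemma gaussianReal_Icc_le {v : ℝ≥0} (hv : v ≠ 0) (y d : ℝ) :
    gaussianReal 0 v (Set.Icc (y - d) (y + d))
      ≤ ENNReal.ofReal ((√(2 * Real.pi * v))⁻¹ * (2 * d)) := by
  rw [gaussianReal_apply _ hv]
  calc ∫⁻ x in Set.Icc (y - d) (y + d), gaussianPDF 0 v x
      ≤ ∫⁻ x in Set.Icc (y - d) (y + d), ENNReal.ofReal (√(2 * Real.pi * v))⁻¹ := by
        gcongr with x
        rw [gaussianPDF, gaussianPDFReal]
        refine ENNReal.ofReal_le_ofReal (mul_le_of_le_one_right (by positivity) ?_)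
        rw [Real.exp_le_one_iff, neg_div]
        exact neg_nonpos.mpr (by positivity)
    _ = _ := by
        rw [setLIntegral_const, Real.volume_Icc, ← ENNReal.ofReal_mul (by positivity)]
        congr 2
        ring

lemma integrable_abs_gaussianReal (w : ℝ≥0) : Integrable (fun x : ℝ => |x|) (gaussianReal 0 w) :=
  ((memLp_id_gaussianReal (μ := 0) (v := w) 1).integrable le_rfl).abs

lemma integrable_sq_gaussianReal (w : ℝ≥0) :
    Integrable (fun x : ℝ => x ^ 2) (gaussianReal 0 w) :=
  (memLp_id_gaussianReal (μ := 0) (v := w) 2).integrable_sq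

lemma integral_sq_gaussianReal (w : ℝ≥0) : ∫ x, x ^ 2 ∂(gaussianReal 0 w) = w := by
  have := variance_fun_id_gaussianReal (μ := 0) (v := w)
  rwa [variance_of_integral_eq_zero aemeasurable_id' (by simp [integral_id_gaussianReal])] at this

lemma integral_abs_gaussianReal (w : ℝ≥0) :
    ∫ x, |x| ∂(gaussianReal 0 w) = √(2 * w / Real.pi) := by
  by_cases hw : w = 0
  · simp [hw, gaussianReal_zero_var]
  have hw0 : (0 : ℝ) < w := by exact_mod_cast pos_iff_ne_zero.mpr hw
  rw [integral_gaussianReal_eq_integral_smul hw]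
  have h1 : ∀ x : ℝ, gaussianPDFReal 0 w x • |x|
      = (fun x : ℝ => (√(2 * Real.pi * w))⁻¹ * (x * Real.exp (-(1 / (2 * w)) * x ^ 2))) |x| := by
    intro x
    simp only [gaussianPDFReal, smul_eq_mul, sub_zero, sq_abs]
    rw [show -x ^ 2 / (2 * (w : ℝ)) = -(1 / (2 * w)) * x ^ 2 by ring]
    ring
  simp_rw [h1]
  rw [integral_comp_abs (f := fun x : ℝ => (√(2 * Real.pi * w))⁻¹ *
    (x * Real.exp (-(1 / (2 * w)) * x ^ 2))), integral_const_mul]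
  have h3 : ∫ x in Set.Ioi (0 : ℝ), x * Real.exp (-(1 / (2 * (w : ℝ))) * x ^ 2) = w := by
    have h2 := integral_rpow_mul_exp_neg_mul_rpow (p := 2) (q := 1) (b := 1 / (2 * (w : ℝ)))
      (by norm_num) (by norm_num) (by positivity)
    simp only [Real.rpow_one, Real.rpow_ofNat] at h2
    rw [h2]
    norm_num
    rw [Real.rpow_neg_one]
    field_simp
  rw [h3, eq_comm, Real.sqrt_eq_iff_mul_self_eq (by positivity) (by positivity)]
  have h4 : √(2 * Real.pi * w) * √(2 * Real.pi * w) = 2 * Real.pi * w :=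
    Real.mul_self_sqrt (by positivity)
  have h5 : √(2 * Real.pi * w) ≠ 0 := by positivity
  have : (2 * ((√(2 * Real.pi * w))⁻¹ * w)) * (2 * ((√(2 * Real.pi * w))⁻¹ * w))
    = 4 * w ^ 2 * (√(2 * Real.pi * w) * √(2 * Real.pi * w))⁻¹ := by
      field_simp
      norm_num
  rw [this, h4]
  field_simp
  norm_num

lemma gaussianReal_prod_cone {v w : ℝ≥0} (hv : v ≠ 0) (y : ℝ) :
    |((gaussianReal 0 v).prod (gaussianReal 0 w)).real {p : ℝ × ℝ | (p.1 - y) ^ 2 < (p.2 / 2) ^ 2}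
      - √(2 * w / Real.pi) * gaussianPDFReal 0 v y|
      ≤ (√(2 * Real.pi * v))⁻¹ * ((1 / 2 + v) / v) * (w / 2) := by
  set K := (√(2 * Real.pi * v))⁻¹ * ((1 / 2 + v) / v) with hK
  have hmeas : MeasurableSet {p : ℝ × ℝ | (p.1 - y) ^ 2 < (p.2 / 2) ^ 2} :=
    measurableSet_lt (by fun_prop) (by fun_prop)
  have hsec : ∀ d : ℝ, (fun a : ℝ => (a, d)) ⁻¹' {p : ℝ × ℝ | (p.1 - y) ^ 2 < (p.2 / 2) ^ 2}
      = Set.Ioo (y - |d| / 2) (y + |d| / 2) := by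
    intro d
    ext a
    simp only [Set.mem_preimage, Set.mem_ofPred_eq, Set.mem_Ioo]
    rw [sq_lt_sq, abs_div, abs_two, abs_lt]
    constructor <;> rintro ⟨h, h'⟩ <;> constructor <;> linarith
  have hint : Integrable (fun d : ℝ =>
      (gaussianReal 0 v).real (Set.Ioo (y - |d| / 2) (y + |d| / 2))) (gaussianReal 0 w) := by
    have := (Measure.integrable_measure_prodMk_left (μ := gaussianReal 0 w) (ν := gaussianReal 0 v)
      (measurable_swap hmeas) (measure_ne_top _ _))
    refine this.congr (ae_of_all _ fun d => ?_)
    simp only [← hsec, measureReal_def]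
    rfl
  have hmain : ((gaussianReal 0 v).prod (gaussianReal 0 w)).real
      {p : ℝ × ℝ | (p.1 - y) ^ 2 < (p.2 / 2) ^ 2}
      = ∫ d, (gaussianReal 0 v).real (Set.Ioo (y - |d| / 2) (y + |d| / 2))
        ∂(gaussianReal 0 w) := by
    rw [measureReal_def, Measure.prod_apply_symm hmeas]
    simp_rw [hsec]
    rw [integral_eq_lintegral_of_nonneg_ae (ae_of_all _ fun _ => measureReal_nonneg)
      hint.aestronglyMeasurable]
    simp
  have hpdf : √(2 * w / Real.pi) * gaussianPDFReal 0 v y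
      = ∫ d, 2 * (|d| / 2) * gaussianPDFReal 0 v y ∂(gaussianReal 0 w) := by
    rw [integral_mul_const, ← integral_abs_gaussianReal]
    congr 2
    ext d
    ring
  have hint2 : Integrable (fun d : ℝ => 2 * (|d| / 2) * gaussianPDFReal 0 v y)
      (gaussianReal 0 w) :=
    (((integrable_abs_gaussianReal w).div_const 2).const_mul 2).mul_const _
  rw [hmain, hpdf, ← integral_sub hint hint2]
  have hle : ∀ d : ℝ, ‖(gaussianReal 0 v).real (Set.Ioo (y - |d| / 2) (y + |d| / 2))
      - 2 * (|d| / 2) * gaussianPDFReal 0 v y‖ ≤ K / 2 * d ^ 2 := by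
    intro d
    refine (gaussianReal_real_Ioo_sub_le hv y (by positivity)).trans (le_of_eq ?_)
    rw [div_pow, sq_abs]
    ring
  refine (norm_integral_le_of_norm_le ((integrable_sq_gaussianReal w).const_mul (K / 2))
    (ae_of_all _ hle)).trans (le_of_eq ?_)
  rw [integral_const_mul, integral_sq_gaussianReal]
  ring

lemma map_prodMk_eq_prod_gaussianReal {Ω : Type*} [MeasurableSpace Ω] {P : Measure Ω}
    [IsProbabilityMeasure P] {A D : Ω → ℝ} (hA : AEMeasurable A P) (hD : AEMeasurable D P)
    {v w : ℝ≥0}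
    (h : ∀ a b : ℝ, P.map (fun ω => a * A ω + b * D ω)
      = gaussianReal 0 (Real.toNNReal (a ^ 2 * v + b ^ 2 * w))) :
    P.map (fun ω => (A ω, D ω)) = (gaussianReal 0 v).prod (gaussianReal 0 w) := by
  have := Measure.isProbabilityMeasure_map (hA.prodMk hD)
  rw [← charFunDual_eq_prod_iff]
  intro L
  have hL : ∀ p : ℝ × ℝ, L p = L (1, 0) * p.1 + L (0, 1) * p.2 := by
    intro p
    conv_lhs => rw [show p = p.1 • ((1, 0) : ℝ × ℝ) + p.2 • ((0, 1) : ℝ × ℝ) by ext <;> simp]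
    rw [map_add, map_smul, map_smul, smul_eq_mul, smul_eq_mul]
    ring
  have hg : ∀ (u : ℝ≥0) (M : StrongDual ℝ ℝ), charFunDual (gaussianReal 0 u) M
      = Complex.exp (- (u * (M 1) ^ 2 / 2 : ℝ)) := by
    intro u M
    rw [charFunDual_eq_charFun_map_one, gaussianReal_map_continuousLinearMap,
      charFun_gaussianReal]
    congr 1
    simp [max_eq_left (sq_nonneg (M 1))]
    ring
  rw [hg, hg, charFunDual_eq_charFun_map_one, AEMeasurable.map_map_of_aemeasurable
    (by fun_prop) (hA.prodMk hD)]
  have hcomp : (L ∘ fun ω => (A ω, D ω)) = fun ω => L (1, 0) * A ω + L (0, 1) * D ω := by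
    ext ω
    exact hL _
  rw [hcomp, h, charFun_gaussianReal, ← Complex.exp_add, Real.coe_toNNReal _ (by positivity)]
  congr 1
  simp
  ring

lemma tendsto_gaussianReal_prod_cone_div {ι : Type*} {l : Filter ι} {v w : ι → ℝ≥0} {h : ι → ℝ}
    {v₀ : ℝ≥0} {c : ℝ} (hv₀ : v₀ ≠ 0) (y : ℝ) (hv : Tendsto v l (𝓝 v₀))
    (hh : Tendsto h l (𝓝 0)) (hpos : ∀ᶠ i in l, 0 < h i)
    (hw : Tendsto (fun i => (w i : ℝ) / h i ^ 2) l (𝓝 c)) :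
    Tendsto (fun i => ((gaussianReal 0 (v i)).prod (gaussianReal 0 (w i))).real
      {p : ℝ × ℝ | (p.1 - y) ^ 2 < (p.2 / 2) ^ 2} / h i) l
      (𝓝 (√(2 * c / Real.pi) * gaussianPDFReal 0 v₀ y)) := by
  have hv₀' : (v₀ : ℝ) ≠ 0 := by exact_mod_cast hv₀
  have hv' : Tendsto (fun i => (v i : ℝ)) l (𝓝 v₀) := NNReal.tendsto_coe.2 hv
  have hnorm : Tendsto (fun i => (√(2 * Real.pi * v i))⁻¹) l (𝓝 (√(2 * Real.pi * v₀))⁻¹) :=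
    (hv'.const_mul (2 * Real.pi)).sqrt.inv₀ (by positivity)
  have hpdf : Tendsto (fun i => gaussianPDFReal 0 (v i) y) l (𝓝 (gaussianPDFReal 0 v₀ y)) := by
    simp only [gaussianPDFReal]
    exact hnorm.mul ((tendsto_const_nhds.div (hv'.const_mul 2) (by positivity)).rexp)
  have hlead : Tendsto (fun i => √(2 * ((w i : ℝ) / h i ^ 2) / Real.pi)
      * gaussianPDFReal 0 (v i) y) l (𝓝 (√(2 * c / Real.pi) * gaussianPDFReal 0 v₀ y)) :=
    ((hw.const_mul 2).div_const Real.pi).sqrt.mul hpdf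
  have herr : Tendsto (fun i => (√(2 * Real.pi * v i))⁻¹ * ((1 / 2 + v i) / v i)
      * ((w i : ℝ) / h i ^ 2 * h i / 2)) l (𝓝 0) := by
    have := (hnorm.mul ((tendsto_const_nhds (x := (1 / 2 : ℝ)).add hv').div hv' hv₀')).mul
      ((hw.mul hh).div_const 2)
    simpa using this
  rw [← tendsto_sub_nhds_zero_iff] at hlead ⊢
  have hdiff : Tendsto (fun i => ((gaussianReal 0 (v i)).prod (gaussianReal 0 (w i))).real
      {p : ℝ × ℝ | (p.1 - y) ^ 2 < (p.2 / 2) ^ 2} / h i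
      - √(2 * ((w i : ℝ) / h i ^ 2) / Real.pi) * gaussianPDFReal 0 (v i) y) l (𝓝 0) := by
    refine squeeze_zero_norm' ?_ herr
    filter_upwards [hpos, hv.eventually_ne hv₀] with i hi hvi
    have hsqrt : √(2 * ((w i : ℝ) / h i ^ 2) / Real.pi) = √(2 * w i / Real.pi) / h i := by
      rw [show 2 * ((w i : ℝ) / h i ^ 2) / Real.pi = 2 * w i / Real.pi / h i ^ 2 by ring,
        Real.sqrt_div (by positivity), Real.sqrt_sq hi.le]
    rw [hsqrt, div_mul_eq_mul_div, ← sub_div, norm_div, Real.norm_eq_abs,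
      Real.norm_of_nonneg hi.le, div_le_iff₀ hi]
    refine (gaussianReal_prod_cone hvi y).trans (le_of_eq ?_)
    field_simp
  have := hdiff.add hlead
  simpa using this

lemma one_sub_cos_eq_sinc_sq (x : ℝ) : 1 - Real.cos x = x ^ 2 / 2 * Real.sinc (x / 2) ^ 2 := by
  have h1 : x / 2 * Real.sinc (x / 2) = Real.sin (x / 2) := by
    by_cases hx : x = 0
    · simp [hx]
    · rw [Real.sinc_of_ne_zero (by simpa using hx)]
      field_simp
  have h2 : Real.cos x = 1 - 2 * Real.sin (x / 2) ^ 2 := by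
    conv_lhs => rw [show x = 2 * (x / 2) by ring]
    rw [Real.cos_two_mul, Real.cos_sq']
    ring
  rw [h2, ← h1]
  ring

lemma tendsto_integral_one_sub_cos_div_sq {μ : Measure ℝ}
    (hmom : Integrable (fun l => l ^ 2) μ) :
    Tendsto (fun h => (∫ l, (1 - Real.cos (h * l)) ∂μ) / h ^ 2) (𝓝[≠] 0)
      (𝓝 ((∫ l, l ^ 2 ∂μ) / 2)) := by
  have hcont : Tendsto (fun h => ∫ l, l ^ 2 / 2 * Real.sinc (h * l / 2) ^ 2 ∂μ) (𝓝 0)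
      (𝓝 (∫ l, l ^ 2 / 2 ∂μ)) := by
    refine tendsto_integral_filter_of_dominated_convergence (fun l => l ^ 2 / 2)
      (Eventually.of_forall fun h => ?_) (Eventually.of_forall fun h => ae_of_all _ fun l => ?_)
      (hmom.div_const 2) (ae_of_all _ fun l => ?_)
    · have := Real.continuous_sinc
      exact Continuous.aestronglyMeasurable (by fun_prop)
    · rw [Real.norm_of_nonneg (by positivity)]
      refine mul_le_of_le_one_right (by positivity) ?_
      rw [sq_le_one_iff_abs_le_one]
      exact Real.abs_sinc_le_one _
    · have : Continuous fun h : ℝ => l ^ 2 / 2 * Real.sinc (h * l / 2) ^ 2 := by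
        have := Real.continuous_sinc
        fun_prop
      simpa using this.tendsto 0
  rw [integral_div] at hcont
  refine (hcont.mono_left nhdsWithin_le_nhds).congr' ?_
  filter_upwards [self_mem_nhdsWithin] with h hh
  have hh : h ≠ 0 := hh
  rw [eq_div_iff (by positivity), ← integral_mul_const]
  congr 1
  ext l
  rw [one_sub_cos_eq_sinc_sq]
  ring

/-- The number of strict sign changes of `f - y` between consecutive points of the grid
`0, h, 2h, …, nh`. -/
noncomputable def signChangeCount (f : ℝ → ℝ) (y h : ℝ) (n : ℕ) : ℕ :=
  ((Finset.range n).filter fun k : ℕ => (f (k * h) - y) * (f ((k + 1) * h) - y) < 0).card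

lemma signChangeCount_le_encard {f : ℝ → ℝ} (hf : Continuous f) (y : ℝ) {t : ℝ} (ht : 0 < t)
    (n : ℕ) :
    (signChangeCount f y (t / n) n : ℕ∞) ≤ Set.encard {s ∈ Set.Icc 0 t | f s = y} := by
  rcases Nat.eq_zero_or_pos n with rfl | hn
  · simp [signChangeCount]
  have hn' : (0 : ℝ) < n := by exact_mod_cast hn
  set h := t / n with hh
  have hpos : 0 < h := by positivity
  have key : ∀ k : ℕ, (f (k * h) - y) * (f ((k + 1) * h) - y) < 0 →
      ∃ s, (k : ℝ) * h < s ∧ s < (k + 1) * h ∧ f s = y := by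
    intro k hk
    have hle : (k : ℝ) * h ≤ (k + 1) * h := by nlinarith
    rcases mul_neg_iff.mp hk with ⟨h1, h2⟩ | ⟨h1, h2⟩
    · obtain ⟨s, hs, hfs⟩ := intermediate_value_Ioo' hle hf.continuousOn
        (show y ∈ Set.Ioo _ _ from ⟨by linarith, by linarith⟩)
      exact ⟨s, hs.1, hs.2, hfs⟩
    · obtain ⟨s, hs, hfs⟩ := intermediate_value_Ioo hle hf.continuousOn
        (show y ∈ Set.Ioo _ _ from ⟨by linarith, by linarith⟩)
      exact ⟨s, hs.1, hs.2, hfs⟩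
  choose! g hg1 hg2 hg3 using key
  rw [signChangeCount, ← Set.encard_coe_eq_coe_finsetCard]
  refine Set.encard_le_encard_of_injOn (f := g) ?_ ?_
  · intro k hk
    simp only [Finset.coe_filter, Finset.mem_range, Set.mem_ofPred_eq] at hk
    refine ⟨⟨(by positivity : (0 : ℝ) ≤ k * h).trans (hg1 k hk.2).le,
      (hg2 k hk.2).le.trans ?_⟩, hg3 k hk.2⟩
    have : ((k : ℝ) + 1) ≤ n := by exact_mod_cast hk.1
    calc ((k : ℝ) + 1) * h ≤ n * h := by gcongr
      _ = t := by rw [hh]; field_simp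
  · intro k hk j hj hkj
    simp only [Finset.coe_filter, Finset.mem_range, Set.mem_ofPred_eq] at hk hj
    have h1 := hg1 k hk.2
    have h2 := hg2 k hk.2
    have h3 := hg1 j hj.2
    have h4 := hg2 j hj.2
    rw [← hkj] at h3 h4
    have h5 : (k : ℝ) < j + 1 := lt_of_mul_lt_mul_right (h1.trans h4) hpos.le
    have h6 : (j : ℝ) < k + 1 := lt_of_mul_lt_mul_right (h3.trans h2) hpos.le
    have h5' : k < j + 1 := by exact_mod_cast h5
    have h6' : j < k + 1 := by exact_mod_cast h6
    omega

lemma exists_forall_mul_neg_of_deriv_ne_zero {f : ℝ → ℝ} {s : ℝ} (hs : deriv f s ≠ 0) :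
    ∃ ε > 0, ∀ a b, s - ε < a → a < s → s < b → b < s + ε → (f a - f s) * (f b - f s) < 0 := by
  have hd := (differentiableAt_of_deriv_ne_zero hs).hasDerivAt
  rw [hasDerivAt_iff_tendsto_slope] at hd
  have h1 : ∀ᶠ x in 𝓝[≠] s, 0 < slope f s x * deriv f s :=
    (hd.mul_const (deriv f s)).eventually_const_lt (mul_self_pos.mpr hs)
  rw [eventually_nhdsWithin_iff, Metric.eventually_nhds_iff] at h1
  obtain ⟨ε, hε, H⟩ := h1
  refine ⟨ε, hε, fun a b ha ha' hb hb' => ?_⟩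
  have hA := H (y := a) (by rw [Real.dist_eq, abs_lt]; constructor <;> linarith) ha'.ne
  have hB := H (y := b) (by rw [Real.dist_eq, abs_lt]; constructor <;> linarith) hb.ne'
  have hAB : 0 < slope f s a * slope f s b := by
    have h2 : 0 < deriv f s * deriv f s := mul_self_pos.mpr hs
    have := mul_pos hA hB
    rw [show slope f s a * deriv f s * (slope f s b * deriv f s)
      = slope f s a * slope f s b * (deriv f s * deriv f s) by ring] at this
    exact pos_of_mul_pos_left this h2.le
  have ea : f a - f s = (a - s) * slope f s a := by
    have := sub_smul_slope f s a
    simpa using this.symm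
  have eb : f b - f s = (b - s) * slope f s b := by
    have := sub_smul_slope f s b
    simpa using this.symm
  rw [ea, eb, show (a - s) * slope f s a * ((b - s) * slope f s b)
    = -((s - a) * (b - s) * (slope f s a * slope f s b)) by ring]
  have : 0 < (s - a) * (b - s) := mul_pos (by linarith) (by linarith)
  have := mul_pos this hAB
  linarith

lemma encard_toENNReal_le {s : Set ℝ} {L : ℝ≥0∞}
    (h : ∀ Z : Finset ℝ, (Z : Set ℝ) ⊆ s → (Z.card : ℝ≥0∞) ≤ L) : (s.encard : ℝ≥0∞) ≤ L := by
  have key : ∀ m : ℕ, (m : ℕ∞) ≤ s.encard → (m : ℝ≥0∞) ≤ L := by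
    intro m hm
    obtain ⟨u, hu, hum⟩ := Set.exists_subset_encard_eq hm
    have hfin := Set.finite_of_encard_eq_coe hum
    have h2 := h hfin.toFinset (by simpa using hu)
    rw [hfin.encard_eq_coe_toFinset_card] at hum
    have : hfin.toFinset.card = m := by exact_mod_cast hum
    rwa [this] at h2
  generalize s.encard = e at key
  induction e using ENat.recTopCoe with
  | top =>
    have : L = ⊤ := by
      rw [eq_top_iff, ← ENNReal.iSup_natCast]
      exact iSup_le fun m => key m le_top
    simp [this]
  | coe m => simpa using key m le_rfl

lemma encard_le_liminf_signChangeCount {f : ℝ → ℝ} {y t : ℝ} (ht : 0 < t)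
    (hgrid : ∀ n k : ℕ, f (k * (t / n)) ≠ y)
    (hderiv : ∀ s ∈ Set.Icc 0 t, f s = y → deriv f s ≠ 0) :
    ((Set.encard {s ∈ Set.Icc 0 t | f s = y}) : ℝ≥0∞)
      ≤ liminf (fun n : ℕ => (signChangeCount f y (t / n) n : ℝ≥0∞)) atTop := by
  refine encard_toENNReal_le fun Z hZ => ?_
  have hlim : Tendsto (fun n : ℕ => t / n) atTop (𝓝 0) := tendsto_const_div_atTop_nhds_zero_nat t
  have hcell : ∀ᶠ n : ℕ in atTop, ∀ s ∈ Z, ∀ a b, s - t / n < a → a < s → s < b → b < s + t / n →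
      (f a - y) * (f b - y) < 0 := by
    rw [Finset.eventually_all]
    intro s hs
    obtain ⟨hsI, hsy⟩ := hZ hs
    obtain ⟨ε, hε, H⟩ := exists_forall_mul_neg_of_deriv_ne_zero (hderiv s hsI hsy)
    filter_upwards [hlim.eventually_lt_const hε] with n hn a b h1 h2 h3 h4
    rw [← hsy]
    exact H a b (by linarith) h2 h3 (by linarith)
  have hsep : ∀ᶠ n : ℕ in atTop, ∀ s ∈ Z, ∀ s' ∈ Z, s ≠ s' → t / n < |s - s'| := by
    rw [Finset.eventually_all]
    intro s hs
    rw [Finset.eventually_all]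
    intro s' hs'
    by_cases hss : s = s'
    · simp [hss]
    · filter_upwards [hlim.eventually_lt_const (abs_pos.mpr (sub_ne_zero.mpr hss))] with n hn _
      exact hn
  refine le_liminf_of_le (by isBoundedDefault) ?_
  filter_upwards [hcell, hsep, eventually_gt_atTop 0] with n hcell hsep hn
  have hn' : (0 : ℝ) < n := by exact_mod_cast hn
  have hpos : 0 < t / n := by positivity
  have hnt : n * (t / n) = t := by field_simp
  have hfl : ∀ s ∈ Z, (⌊s / (t / n)⌋₊ : ℝ) * (t / n) < s ∧
      s < (⌊s / (t / n)⌋₊ + 1) * (t / n) := by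
    intro s hs
    obtain ⟨hsI, hsy⟩ := hZ hs
    constructor
    · have h1 := Nat.floor_le (div_nonneg hsI.1 hpos.le)
      rw [le_div_iff₀ hpos] at h1
      refine lt_of_le_of_ne h1 fun h2 => hgrid n ⌊s / (t / n)⌋₊ ?_
      rw [h2, hsy]
    · have h1 := Nat.lt_floor_add_one (s / (t / n))
      rwa [div_lt_iff₀ hpos] at h1
  rw [signChangeCount]
  refine Nat.cast_le.mpr (Finset.card_le_card_of_injOn (fun s => ⌊s / (t / n)⌋₊) ?_ ?_)
  · intro s hs
    obtain ⟨h1, h2⟩ := hfl s hs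
    simp only [Finset.coe_filter, Finset.mem_range, Set.mem_ofPred_eq]
    refine ⟨?_, hcell s hs _ _ (by linarith) h1 h2 (by linarith)⟩
    have h3 : (⌊s / (t / n)⌋₊ : ℝ) * (t / n) < n * (t / n) := by
      rw [hnt]
      exact h1.trans_le (hZ hs).1.2
    exact_mod_cast lt_of_mul_lt_mul_right h3 hpos.le
  · intro s hs s' hs' hss
    by_contra hne
    obtain ⟨h1, h2⟩ := hfl s hs
    obtain ⟨h3, h4⟩ := hfl s' hs'
    simp only at hss
    rw [← hss] at h3 h4
    have h5 := hsep s hs s' hs' hne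
    have h6 : |s - s'| < t / n := by
      rw [abs_lt]
      constructor <;> linarith
    linarith

/-- The Bulinskaya lemma: almost surely no path is tangent to the level `y` on `[0, t]`. -/
lemma ae_deriv_ne_zero_of_eq {Ω : Type*} [MeasurableSpace Ω] {P : Measure Ω} {X : Ω → ℝ → ℝ}
    {y t C : ℝ} (ht : 0 < t) (hC : 0 ≤ C) (hpaths : ∀ᵐ ω ∂P, ContDiff ℝ 1 (X ω))
    (hsmall : ∀ s d, P {ω | |X ω s - y| ≤ d} ≤ ENNReal.ofReal (C * d)) :
    ∀ᵐ ω ∂P, ∀ s ∈ Set.Icc 0 t, X ω s = y → deriv (X ω) s ≠ 0 := by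
  let T : Set Ω := {ω | ContDiff ℝ 1 (X ω) ∧ ∃ s ∈ Set.Icc 0 t, X ω s = y ∧ deriv (X ω) s = 0}
  suffices hT : P T = 0 by
    filter_upwards [hpaths, measure_eq_zero_iff_ae_notMem.mp hT] with ω h1 h2 s hs hy hd
    exact h2 ⟨h1, s, hs, hy, hd⟩
  have hbound : ∀ ε : ℝ, 0 < ε → P T ≤ ENNReal.ofReal (2 * C * t * ε) := by
    intro ε hε
    let B : ℕ → Set Ω := fun n => {ω | ω ∈ T ∧ ∀ a ∈ Set.Icc 0 t, ∀ b ∈ Set.Icc 0 t,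
      |a - b| ≤ t / (n + 1) → |deriv (X ω) a - deriv (X ω) b| ≤ ε}
    have hmono : Monotone B := by
      intro n m hnm ω hω
      refine ⟨hω.1, fun a ha b hb hab => hω.2 a ha b hb (hab.trans ?_)⟩
      have : (n : ℝ) ≤ m := by exact_mod_cast hnm
      gcongr
    have hcover : T ⊆ ⋃ n, B n := by
      intro ω hω
      have huc := isCompact_Icc.uniformContinuousOn_of_continuous
        (hω.1.continuous_deriv le_rfl).continuousOn (s := Set.Icc 0 t)
      obtain ⟨δ, hδ, H⟩ := Metric.uniformContinuousOn_iff.mp huc ε hε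
      have hlim : Tendsto (fun n : ℕ => t / ((n : ℝ) + 1)) atTop (𝓝 0) := by
        have := (tendsto_const_div_atTop_nhds_zero_nat t).comp (tendsto_add_atTop_nat 1)
        simpa [Function.comp_def] using this
      obtain ⟨n, hn⟩ := (hlim.eventually_lt_const hδ).exists
      refine Set.mem_iUnion.mpr ⟨n, hω, fun a ha b hb hab => ?_⟩
      exact (H a ha b hb (hab.trans_lt hn)).le
    have hB : ∀ n, P (B n) ≤ ENNReal.ofReal (2 * C * t * ε) := by
      intro n
      have hn1 : (0 : ℝ) < n + 1 := by positivity
      set h := t / ((n : ℝ) + 1) with hh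
      have hpos : 0 < h := by positivity
      have hnt : ((n : ℝ) + 1) * h = t := by rw [hh]; field_simp
      have hsub : B n ⊆ ⋃ k ∈ Finset.range (n + 2), {ω | |X ω (k * h) - y| ≤ ε * h} := by
        rintro ω ⟨⟨hdiff, s, hs, hsy, hsd⟩, hmod⟩
        set k := ⌊s / h⌋₊ with hk
        have h1 : (k : ℝ) * h ≤ s := by
          have := Nat.floor_le (div_nonneg hs.1 hpos.le)
          rwa [le_div_iff₀ hpos] at this
        have h2 : s < (k + 1) * h := by
          have := Nat.lt_floor_add_one (s / h)
          rwa [div_lt_iff₀ hpos] at this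
        have hk0 : 0 ≤ (k : ℝ) * h := by positivity
        have hkn : k < n + 2 := by
          have h3 : (k : ℝ) * h ≤ (n + 1) * h := by
            rw [hnt]
            exact h1.trans hs.2
          have h4 : (k : ℝ) ≤ n + 1 := le_of_mul_le_mul_right h3 hpos
          have h5 : k ≤ n + 1 := by exact_mod_cast h4
          omega
        simp only [Set.mem_iUnion]
        refine ⟨k, Finset.mem_range.mpr hkn, ?_⟩
        have hmv := (convex_Icc (k * h) s).norm_image_sub_le_of_norm_deriv_le (f := X ω) (C := ε)
          (fun x _ => (hdiff.differentiable one_ne_zero) x) (fun x hx => by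
            have := hmod x ⟨hk0.trans hx.1, hx.2.trans hs.2⟩ s hs (by
              rw [abs_le]
              constructor <;> linarith [hx.1, hx.2])
            rwa [hsd, sub_zero] at this)
          (Set.right_mem_Icc.mpr h1) (Set.left_mem_Icc.mpr h1)
        rw [hsy, Real.norm_eq_abs, Real.norm_eq_abs] at hmv
        refine hmv.trans ?_
        gcongr
        rw [abs_le]
        constructor <;> linarith
      calc P (B n) ≤ ∑ k ∈ Finset.range (n + 2), P {ω | |X ω (k * h) - y| ≤ ε * h} :=
            (measure_mono hsub).trans (measure_biUnion_finset_le _ _)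
        _ ≤ ∑ k ∈ Finset.range (n + 2), ENNReal.ofReal (C * (ε * h)) :=
            Finset.sum_le_sum fun k _ => hsmall _ _
        _ = ENNReal.ofReal ((n + 2) * (C * (ε * h))) := by
            rw [Finset.sum_const, Finset.card_range, nsmul_eq_mul,
              ENNReal.ofReal_mul (p := (n : ℝ) + 2) (by positivity)]
            congr 1
            exact_mod_cast (ENNReal.ofReal_natCast (n + 2)).symm
        _ ≤ ENNReal.ofReal (2 * C * t * ε) := by
            refine ENNReal.ofReal_le_ofReal ?_
            have h1 : 0 ≤ n * (C * (ε * h)) := by positivity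
            rw [← hnt]
            linarith
    calc P T ≤ P (⋃ n, B n) := measure_mono hcover
      _ = ⨆ n, P (B n) := hmono.measure_iUnion
      _ ≤ _ := iSup_le hB
  have hlim : Tendsto (fun ε : ℝ => ENNReal.ofReal (2 * C * t * ε)) (𝓝[>] 0) (𝓝 0) := by
    have : Continuous fun ε : ℝ => ENNReal.ofReal (2 * C * t * ε) :=
      ENNReal.continuous_ofReal.comp (by fun_prop)
    simpa using (this.tendsto 0).mono_left nhdsWithin_le_nhds
  refine le_antisymm (ge_of_tendsto hlim ?_) zero_le
  filter_upwards [self_mem_nhdsWithin] with ε hε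
  exact hbound ε hε

lemma signChangeCount_eq_sum_indicator {Ω : Type*} (X : Ω → ℝ → ℝ) (y h : ℝ) (n : ℕ) :
    (fun ω => (signChangeCount (X ω) y h n : ℝ≥0∞)) = fun ω => ∑ k ∈ Finset.range n,
      Set.indicator {ω | (X ω (k * h) - y) * (X ω ((k + 1) * h) - y) < 0}
        (fun _ => (1 : ℝ≥0∞)) ω := by
  ext ω
  simp [signChangeCount, Set.indicator_apply]

lemma nullMeasurableSet_signChange {Ω : Type*} [MeasurableSpace Ω] {P : Measure Ω}
    {X : Ω → ℝ → ℝ} (hX : ∀ s, AEMeasurable (fun ω => X ω s) P) (y a b : ℝ) :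
    NullMeasurableSet {ω | (X ω a - y) * (X ω b - y) < 0} P :=
  nullMeasurableSet_lt (((hX _).sub_const y).mul ((hX _).sub_const y)) aemeasurable_const

lemma aemeasurable_signChangeCount {Ω : Type*} [MeasurableSpace Ω] {P : Measure Ω}
    {X : Ω → ℝ → ℝ} (hX : ∀ s, AEMeasurable (fun ω => X ω s) P) (y h : ℝ) (n : ℕ) :
    AEMeasurable (fun ω => (signChangeCount (X ω) y h n : ℝ≥0∞)) P := by
  rw [signChangeCount_eq_sum_indicator]
  exact Finset.aemeasurable_fun_sum _ fun k _ =>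
    aemeasurable_const.indicator₀ (nullMeasurableSet_signChange hX y _ _)

lemma lintegral_signChangeCount {Ω : Type*} [MeasurableSpace Ω] {P : Measure Ω}
    {X : Ω → ℝ → ℝ} (hX : ∀ s, AEMeasurable (fun ω => X ω s) P) (y h : ℝ) (n : ℕ) :
    ∫⁻ ω, (signChangeCount (X ω) y h n : ℝ≥0∞) ∂P
      = ∑ k ∈ Finset.range n, P {ω | (X ω (k * h) - y) * (X ω ((k + 1) * h) - y) < 0} := by
  rw [signChangeCount_eq_sum_indicator, lintegral_finsetSum' _ fun k _ =>
    aemeasurable_const.indicator₀ (nullMeasurableSet_signChange hX y _ _)]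
  refine Finset.sum_congr rfl fun k _ => ?_
  rw [lintegral_indicator_const₀ (nullMeasurableSet_signChange hX y _ _), one_mul]

lemma measure_signChange_eq {Ω : Type*} [MeasurableSpace Ω] {P : Measure Ω}
    [IsProbabilityMeasure P] {U V : Ω → ℝ} (hU : AEMeasurable U P) (hV : AEMeasurable V P)
    {σ ρ : ℝ} (h1 : 0 ≤ σ + ρ) (h2 : 0 ≤ σ - ρ)
    (hUV : ∀ a b : ℝ, P.map (fun ω => a * U ω + b * V ω)
      = gaussianReal 0 (Real.toNNReal ((a ^ 2 + b ^ 2) * σ + 2 * a * b * ρ))) (y : ℝ) :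
    P {ω | (U ω - y) * (V ω - y) < 0}
      = ((gaussianReal 0 (Real.toNNReal ((σ + ρ) / 2))).prod
          (gaussianReal 0 (Real.toNNReal (2 * (σ - ρ)))))
        {p : ℝ × ℝ | (p.1 - y) ^ 2 < (p.2 / 2) ^ 2} := by
  have hA : AEMeasurable (fun ω => (U ω + V ω) / 2) P := (hU.add hV).div_const 2
  have hD : AEMeasurable (fun ω => V ω - U ω) P := hV.sub hU
  have hmeas : MeasurableSet {p : ℝ × ℝ | (p.1 - y) ^ 2 < (p.2 / 2) ^ 2} :=
    measurableSet_lt (by fun_prop) (by fun_prop)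
  rw [← map_prodMk_eq_prod_gaussianReal hA hD,
    Measure.map_apply_of_aemeasurable (hA.prodMk hD) hmeas]
  · congr 1
    ext ω
    simp only [Set.mem_preimage, Set.mem_ofPred_eq]
    constructor <;> intro h <;> nlinarith
  · intro a b
    rw [Real.coe_toNNReal _ (by positivity), Real.coe_toNNReal _ (by positivity)]
    convert hUV (a / 2 - b) (a / 2 + b) using 3
    · ring
    · ring

/-- Rice formula for a centered stationary Gaussian process `X` on `ℝ` with covariance `r`,
spectral measure `μ` not purely discrete, `r(0) = lam0 > 0`, finite second spectral moment
`lam2 = -r''(0)`, and `C¹` sample paths: for every level `y` and `t > 0`,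
`E[N^X_{[0,t]}(y)] = (t/π) √(lam2/lam0) exp(-y²/(2lam0))`. -/
theorem stmt_10 {Ω : Type*} [MeasurableSpace Ω] (P : Measure Ω) [IsProbabilityMeasure P]
    (X : Ω → ℝ → ℝ) (r : ℝ → ℝ) (μ : Measure ℝ) [IsFiniteMeasure μ]
    (lam0 lam2 : ℝ) (hlam0pos : 0 < lam0) (hr0 : r 0 = lam0)
    (hspec : ∀ t, r t = ∫ l, Real.cos (t * l) ∂μ)
    (hnotdisc : ¬ ∃ s : Set ℝ, s.Countable ∧ μ sᶜ = 0)
    (hmom : Integrable (fun l => l ^ 2) μ) (hlam2 : lam2 = ∫ l, l ^ 2 ∂μ)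
    (hr'' : deriv (deriv r) 0 = -lam2)
    (hGauss : ∀ (k : ℕ) (ts : Fin k → ℝ) (c : Fin k → ℝ),
      Measure.map (fun ω => ∑ i, c i * X ω (ts i)) P
        = gaussianReal 0 (Real.toNNReal (∑ i, ∑ i', c i * c i' * r (ts i - ts i'))))
    (hpaths : ∀ᵐ ω ∂P, ContDiff ℝ 1 (X ω))
    (y t : ℝ) (ht : 0 < t) :
    ∫⁻ ω, ((Set.encard {s ∈ Set.Icc 0 t | X ω s = y}) : ℝ≥0∞) ∂P
      = ENNReal.ofReal
          ((t / Real.pi) * Real.sqrt (lam2 / lam0) * Real.exp (-y ^ 2 / (2 * lam0))) := by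
  have hXsum : ∀ s s' a b, P.map (fun ω => a * X ω s + b * X ω s')
      = gaussianReal 0 (Real.toNNReal ((a ^ 2 + b ^ 2) * lam0 + 2 * a * b * r (s' - s))) := by
    intro s s' a b
    have hsymm : r (s - s') = r (s' - s) := by
      rw [hspec, hspec]
      congr 1
      ext l
      rw [← Real.cos_neg]
      ring_nf
    have := hGauss 2 ![s, s'] ![a, b]
    simp only [Fin.sum_univ_two, Matrix.cons_val_zero, Matrix.cons_val_one, sub_self, hr0,
      hsymm] at this
    rw [this]
    ring_nf
  have hX : ∀ s, P.map (fun ω => X ω s) = gaussianReal 0 (Real.toNNReal lam0) := by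
    intro s
    have := hXsum s s 1 0
    simpa using this
  have hXm : ∀ s, AEMeasurable (fun ω => X ω s) P := fun s =>
    AEMeasurable.of_map_ne_zero (by rw [hX s]; exact IsProbabilityMeasure.ne_zero _)
  have hv₀ : Real.toNNReal lam0 ≠ 0 := by simpa using hlam0pos
  have hcosint : ∀ h : ℝ, Integrable (fun l => Real.cos (h * l)) μ := fun h =>
    Integrable.of_bound (C := 1)
      (Continuous.aestronglyMeasurable (by fun_prop))
      (ae_of_all _ fun l => by rw [Real.norm_eq_abs]; exact Real.abs_cos_le_one _)
  have hlam0 : lam0 = ∫ _, (1 : ℝ) ∂μ := by rw [← hr0, hspec]; simp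
  have hsub : ∀ h, lam0 - r h = ∫ l, (1 - Real.cos (h * l)) ∂μ := fun h => by
    rw [integral_sub (integrable_const _) (hcosint h), ← hspec, ← hlam0]
  have hsub_nonneg : ∀ h, 0 ≤ lam0 - r h := fun h => by
    rw [hsub]
    exact integral_nonneg fun l => sub_nonneg.mpr (Real.cos_le_one _)
  have hadd_nonneg : ∀ h, 0 ≤ lam0 + r h := fun h => by
    rw [hspec, hlam0, ← integral_add (integrable_const _) (hcosint h)]
    exact integral_nonneg fun l => by
      have := Real.neg_one_le_cos (h * l)
      simp only [Pi.zero_apply]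
      linarith
  have hgrid : ∀ᵐ ω ∂P, ∀ n k : ℕ, X ω (k * (t / n)) ≠ y := by
    rw [ae_all_iff]
    intro n
    rw [ae_all_iff]
    intro k
    have := nullSingletonClass_gaussianReal (μ := 0) hv₀
    have h0 : P.map (fun ω => X ω (k * (t / n))) {y} = 0 := by
      rw [hX]
      exact measure_singleton y
    rw [Measure.map_apply_of_aemeasurable (hXm _) (measurableSet_singleton y)] at h0
    exact measure_eq_zero_iff_ae_notMem.mp h0
  have hderiv : ∀ᵐ ω ∂P, ∀ s ∈ Set.Icc 0 t, X ω s = y → deriv (X ω) s ≠ 0 := by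
    refine ae_deriv_ne_zero_of_eq (C := (√(2 * Real.pi * lam0.toNNReal))⁻¹ * 2) ht (by positivity)
      hpaths fun s d => ?_
    have : {ω | |X ω s - y| ≤ d} = (fun ω => X ω s) ⁻¹' Set.Icc (y - d) (y + d) := by
      ext ω
      simp only [Set.mem_preimage, Set.mem_ofPred_eq, Set.mem_Icc, abs_le]
      constructor <;> rintro ⟨h, h'⟩ <;> constructor <;> linarith
    rw [this, ← Measure.map_apply_of_aemeasurable (hXm s) measurableSet_Icc, hX, mul_assoc]
    exact gaussianReal_Icc_le hv₀ y d
  let h : ℕ → ℝ := fun n => t / n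
  have hlim : Tendsto h atTop (𝓝 0) := tendsto_const_div_atTop_nhds_zero_nat t
  have hpos : ∀ᶠ n in atTop, 0 < h n := by
    filter_upwards [eventually_gt_atTop 0] with n hn
    have : (0 : ℝ) < n := by exact_mod_cast hn
    positivity
  have hsub_lim : Tendsto (fun n => (lam0 - r (h n)) / h n ^ 2) atTop (𝓝 (lam2 / 2)) := by
    simp_rw [hsub, hlam2]
    refine (tendsto_integral_one_sub_cos_div_sq hmom).comp ?_
    exact tendsto_nhdsWithin_iff.mpr ⟨hlim, hpos.mono fun n hn => hn.ne'⟩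
  have hr_lim : Tendsto (fun n => r (h n)) atTop (𝓝 lam0) := by
    have h1 := (hsub_lim.mul (hlim.pow 2)).const_sub lam0
    simp only [ne_eq, OfNat.ofNat_ne_zero, not_false_eq_true, zero_pow, mul_zero, sub_zero] at h1
    refine h1.congr' ?_
    filter_upwards [hpos] with n hn
    field_simp
    ring
  let G : ℕ → Measure (ℝ × ℝ) := fun n =>
    (gaussianReal 0 (Real.toNNReal ((lam0 + r (h n)) / 2))).prod
      (gaussianReal 0 (Real.toNNReal (2 * (lam0 - r (h n)))))
  let S : Set (ℝ × ℝ) := {p | (p.1 - y) ^ 2 < (p.2 / 2) ^ 2}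
  have hcone : Tendsto (fun n => (G n).real S / h n) atTop
      (𝓝 (√(2 * lam2 / Real.pi) * gaussianPDFReal 0 lam0.toNNReal y)) := by
    refine tendsto_gaussianReal_prod_cone_div hv₀ y ?_ hlim hpos ?_
    · refine (continuous_real_toNNReal.tendsto lam0).comp ?_
      have := (hr_lim.const_add lam0).div_const 2
      simpa using this
    · have := hsub_lim.const_mul 2
      rw [mul_div_cancel₀ _ two_ne_zero] at this
      refine this.congr fun n => ?_
      rw [Real.coe_toNNReal _ (mul_nonneg zero_le_two (hsub_nonneg _))]
      ring
  have hcount : ∀ n : ℕ, ∫⁻ ω, (signChangeCount (X ω) y (h n) n : ℝ≥0∞) ∂P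
      = ENNReal.ofReal (t * ((G n).real S / h n)) := by
    intro n
    rw [lintegral_signChangeCount hXm]
    have hk : ∀ k ∈ Finset.range n,
        P {ω | (X ω (k * h n) - y) * (X ω ((k + 1) * h n) - y) < 0} = G n S := by
      intro k _
      refine measure_signChange_eq (hXm _) (hXm _) (hadd_nonneg _) (hsub_nonneg _)
        (fun a b => ?_) y
      rw [hXsum]
      ring_nf
    rw [Finset.sum_congr rfl hk, Finset.sum_const, Finset.card_range, nsmul_eq_mul]
    rcases Nat.eq_zero_or_pos n with rfl | hn
    · simp [h]
    have hn' : (0 : ℝ) < n := by exact_mod_cast hn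
    have : t * ((G n).real S / h n) = n * (G n).real S := by
      simp only [h]
      field_simp
    rw [this, ENNReal.ofReal_mul hn'.le, ENNReal.ofReal_natCast, ofReal_measureReal]
  have hlim_count : Tendsto (fun n : ℕ => ∫⁻ ω, (signChangeCount (X ω) y (h n) n : ℝ≥0∞) ∂P) atTop
      (𝓝 (ENNReal.ofReal
        (t * (√(2 * lam2 / Real.pi) * gaussianPDFReal 0 lam0.toNNReal y)))) := by
    simp_rw [hcount]
    exact (ENNReal.continuous_ofReal.tendsto _).comp (hcone.const_mul t)
  have hconst : t * (√(2 * lam2 / Real.pi) * gaussianPDFReal 0 lam0.toNNReal y)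
      = (t / Real.pi) * Real.sqrt (lam2 / lam0) * Real.exp (-y ^ 2 / (2 * lam0)) := by
    have hlam2_nonneg : 0 ≤ lam2 := hlam2 ▸ integral_nonneg fun l => sq_nonneg l
    have hsqrt : √(2 * lam2 / Real.pi) * (√(2 * Real.pi * lam0))⁻¹
        = √(lam2 / lam0) / Real.pi := by
      rw [← Real.sqrt_inv, ← Real.sqrt_mul (by positivity),
        show 2 * lam2 / Real.pi * (2 * Real.pi * lam0)⁻¹ = lam2 / lam0 / Real.pi ^ 2 by field_simp,
        Real.sqrt_div (by positivity), Real.sqrt_sq Real.pi_pos.le]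
    rw [gaussianPDFReal, Real.coe_toNNReal _ hlam0pos.le, ← mul_assoc √_, hsqrt, sub_zero]
    ring
  rw [← hconst]
  refine le_antisymm ?_ (le_of_tendsto' hlim_count fun n => lintegral_mono_ae ?_)
  · calc ∫⁻ ω, ((Set.encard {s ∈ Set.Icc 0 t | X ω s = y}) : ℝ≥0∞) ∂P
        ≤ ∫⁻ ω, liminf (fun n : ℕ => (signChangeCount (X ω) y (h n) n : ℝ≥0∞)) atTop ∂P := by
          refine lintegral_mono_ae ?_
          filter_upwards [hgrid, hderiv] with ω h1 h2
          exact encard_le_liminf_signChangeCount ht h1 h2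
      _ ≤ liminf (fun n : ℕ => ∫⁻ ω, (signChangeCount (X ω) y (h n) n : ℝ≥0∞) ∂P) atTop :=
          lintegral_liminf_le' fun n => aemeasurable_signChangeCount hXm y (h n) n
      _ = _ := hlim_count.liminf_eq
  · filter_upwards [hpaths] with ω hω
    exact_mod_cast ENat.toENNReal_le.mpr (signChangeCount_le_encard hω.continuous y ht n)
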